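/- Let T be a Y(2|1) T-family in A, let a ≥ 0, b ≥ 1, and let ū = (u₁,…,u_a), v̄ = (v₁,…,v_b) be lists whose concatenation is admissible. Then h(v̄_b, v_b)·Y_{a,b}(ū,v̄) = T₂₃(v_b)·Y_{a,b−1}(ū, v̄_b) + Σ_{j=1}^{a} g(v_b,uⱼ)·f(v̄_b,uⱼ)·f(uⱼ,ūⱼ)·T₁₃(v_b)·Y_{a−1,b−1}(ūⱼ, v̄_b)·T₂₂(uⱼ), where v̄_b = v̄ with v_b removed, ūⱼ = ū with uⱼ removed, h(v̄_b,v_b) = ∏_{k<b} h(vₖ,v_b), f(v̄_b,uⱼ) = ∏_{k<b} f(vₖ,uⱼ) and f(uⱼ,ūⱼ) = ∏_{k≠j} f(uⱼ,uₖ). -/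

import Mathlib

open scoped BigOperators
open MulOpposite

noncomputable section

namespace Bethe

variable {A : Type*} [Ring A] [Algebra ℂ A]

/-- `g(u,v) = c/(u-v)` -/
def gg (c u v : ℂ) : ℂ := c / (u - v)

/-- `f(u,v) = (u-v+c)/(u-v)` -/
def ff (c u v : ℂ) : ℂ := (u - v + c) / (u - v)

/-- `h(u,v) = (u-v+c)/c` -/
def hh (c u v : ℂ) : ℂ := (u - v + c) / c

/-- A list of parameters is admissible if its entries are pairwise distinct and
`x - y + c ≠ 0` for any two distinct entries `x`, `y`. -/
def Admissible (c : ℂ) (l : List ℂ) : Prop :=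
  l.Pairwise fun x y => x ≠ y ∧ x - y + c ≠ 0 ∧ y - x + c ≠ 0

/-- `∏_{x ∈ xs} ∏_{y ∈ ys} f(x,y)` -/
def prodFF (c : ℂ) (xs ys : List ℂ) : ℂ :=
  (xs.map fun x => (ys.map fun y => ff c x y).prod).prod

/-- `∏_{x ∈ xs} ∏_{y ∈ ys} g(x,y)` -/
def prodGG (c : ℂ) (xs ys : List ℂ) : ℂ :=
  (xs.map fun x => (ys.map fun y => gg c x y).prod).prod

/-- `∏_{x ∈ xs} ∏_{y ∈ ys} h(x,y)` -/
def prodHH (c : ℂ) (xs ys : List ℂ) : ℂ :=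
  (xs.map fun x => (ys.map fun y => hh c x y).prod).prod

/-- `H(w̄) = ∏_{j>k} h(wⱼ,wₖ)` -/
def Hnorm (c : ℂ) : List ℂ → ℂ
  | [] => 1
  | x :: xs => ((xs.map fun y => hh c y x).prod) * Hnorm c xs

/-- `H(w̄*) = ∏_{j<k} h(wⱼ,wₖ)` -/
def HnormRev (c : ℂ) : List ℂ → ℂ
  | [] => 1
  | x :: xs => ((xs.map fun y => hh c x y).prod) * HnormRev c xs

/-- product of `h` over ordered pairs of distinct positions of a list -/
def prodHHne (c : ℂ) (xs : List ℂ) : ℂ :=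
  ∏ j : Fin xs.length, ∏ k : Fin xs.length,
    if j ≠ k then hh c (xs.get j) (xs.get k) else 1

/-- ordered product `T(w₁)⋯T(wₙ)` -/
def Tprod (Tij : ℂ → A) (l : List ℂ) : A := (l.map Tij).prod

/-- normalized ordered product `H(w̄)⁻¹ T(w₁)⋯T(wₙ)` -/
def TT (c : ℂ) (Tij : ℂ → A) (l : List ℂ) : A := (Hnorm c l)⁻¹ • Tprod Tij l

/-- normalized ordered product `H(w̄*)⁻¹ T(w₁)⋯T(wₙ)` -/
def TTrev (c : ℂ) (Tij : ℂ → A) (l : List ℂ) : A := (HnormRev c l)⁻¹ • Tprod Tij l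

/-- The defining (RTT) commutation relations of a super-Yangian `T`-family with
`ℤ₂`-grading `p`. -/
def IsTFam (c : ℂ) {N : ℕ} (p : Fin N → ℕ) (T : Fin N → Fin N → ℂ → A) : Prop :=
  ∀ i j k l : Fin N, ∀ z w : ℂ, z ≠ w →
    T i j z * T k l w - ((-1 : ℂ) ^ ((p i + p j) * (p k + p l))) • (T k l w * T i j z)
      = ((-1 : ℂ) ^ (p l * (p i + p j) + p i * p j) * gg c z w) •
          (T i l z * T k j w - T i l w * T k j z)

/-- the distinguished grading of `gl(2|1)`: `[1]=[2]=0`, `[3]=1` -/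
def p21 : Fin 3 → ℕ := ![0, 0, 1]

/-- the distinguished grading of `gl(1|2)`: `[1]=0`, `[2]=[3]=1` -/
def p12 : Fin 3 → ℕ := ![0, 1, 1]

/-- the sublist of `l` given by the positions in `S`, in the inherited order -/
def sel (l : List ℂ) (S : Finset (Fin l.length)) : List ℂ :=
  (S.sort (· ≤ ·)).map l.get

/-- `λ(w̄) = ∏ⱼ λ(wⱼ)` -/
def lamP (lam2 : ℂ → ℂ) (l : List ℂ) : ℂ := (l.map lam2).prod

/-- The Izergin kernel `K_ℓ(v̄|ū)`. -/
def Kiz (c : ℂ) {ℓ : ℕ} (vs us : Fin ℓ → ℂ) : ℂ :=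
  (∏ j : Fin ℓ, ∏ k : Fin ℓ, if (k : ℕ) < (j : ℕ) then gg c (vs j) (vs k) else 1) *
    (∏ j : Fin ℓ, ∏ k : Fin ℓ, if (k : ℕ) < (j : ℕ) then gg c (us k) (us j) else 1) *
    (∏ j : Fin ℓ, ∏ k : Fin ℓ, hh c (vs j) (us k)) *
    Matrix.det (Matrix.of fun j k => gg c (vs j) (us k) / hh c (vs j) (us k))

/-- The Izergin kernel for lists of equal length (and junk value `0` otherwise). -/
def KizL (c : ℂ) (vs us : List ℂ) : ℂ :=
  if h : vs.length = us.length then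
    Kiz c vs.get fun j => us.get (Fin.cast h j)
  else 0

/-- The operator `X_{a,b}(ū,v̄)` of the paper (`Y(2|1)` case). -/
def X (c : ℂ) (T : Fin 3 → Fin 3 → ℂ → A) (u v : List ℂ) : A :=
  ∑ S : Finset (Fin u.length), ∑ Q : Finset (Fin v.length),
    if S.card = Q.card then
      (prodGG c (sel v Q) (sel u S) * prodFF c (sel u S) (sel u Sᶜ) *
          prodGG c (sel v Qᶜ) (sel v Q) * prodHHne c (sel u S)) •
        (TT c (T 0 2) (sel u S) * Tprod (T 0 1) (sel u Sᶜ) *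
          TT c (T 1 2) (sel v Qᶜ) * Tprod (T 1 1) (sel v Q))
    else 0

/-- The operator `Y_{a,b}(ū,v̄)` of the paper (`Y(2|1)` case). -/
def Y (c : ℂ) (T : Fin 3 → Fin 3 → ℂ → A) (u v : List ℂ) : A :=
  ∑ S : Finset (Fin u.length), ∑ Q : Finset (Fin v.length),
    if S.card = Q.card then
      (KizL c (sel v Q) (sel u S) * prodFF c (sel u S) (sel u Sᶜ) *
          prodGG c (sel v Qᶜ) (sel v Q)) •
        (TT c (T 0 2) (sel v Q) * TT c (T 1 2) (sel v Qᶜ) *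
          Tprod (T 0 1) (sel u Sᶜ) * Tprod (T 1 1) (sel u S))
    else 0

/-- First explicit expression for the `Y(2|1)` Bethe vector (operator part,
the weights `λ₂` included as scalars). -/
def PhiA (c : ℂ) (T : Fin 3 → Fin 3 → ℂ → A) (lam2 : ℂ → ℂ) (u v : List ℂ) : A :=
  ∑ S : Finset (Fin u.length), ∑ Q : Finset (Fin v.length),
    if S.card = Q.card then
      (prodGG c (sel v Q) (sel u S) * prodFF c (sel u S) (sel u Sᶜ) *
          prodGG c (sel v Qᶜ) (sel v Q) * prodHHne c (sel u S) * lamP lam2 (sel v Q)) •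
        (TT c (T 0 2) (sel u S) * Tprod (T 0 1) (sel u Sᶜ) * TT c (T 1 2) (sel v Qᶜ))
    else 0

/-- Second explicit expression for the `Y(2|1)` Bethe vector (operator part). -/
def PhiB (c : ℂ) (T : Fin 3 → Fin 3 → ℂ → A) (lam2 : ℂ → ℂ) (u v : List ℂ) : A :=
  ∑ S : Finset (Fin u.length), ∑ Q : Finset (Fin v.length),
    if S.card = Q.card then
      (KizL c (sel v Q) (sel u S) * prodFF c (sel u S) (sel u Sᶜ) *
          prodGG c (sel v Qᶜ) (sel v Q) * lamP lam2 (sel u S)) •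
        (TT c (T 0 2) (sel v Q) * TT c (T 1 2) (sel v Qᶜ) * Tprod (T 0 1) (sel u Sᶜ))
    else 0

/-- First explicit expression for the `Y(1|2)` Bethe vector, without the overall
sign `(-1)^b` (operator part). -/
def PhiTA (c : ℂ) (T : Fin 3 → Fin 3 → ℂ → A) (lam2 : ℂ → ℂ) (u v : List ℂ) : A :=
  ∑ S : Finset (Fin u.length), ∑ Q : Finset (Fin v.length),
    if S.card = Q.card then
      (prodGG c (sel u S) (sel v Q) * prodFF c (sel v Q) (sel v Qᶜ) *
          prodGG c (sel u Sᶜ) (sel u S) * prodHHne c (sel v Q) * lamP lam2 (sel u S)) •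
        (TT c (T 0 2) (sel v Q) * Tprod (T 1 2) (sel v Qᶜ) * TT c (T 0 1) (sel u Sᶜ))
    else 0

/-- Second explicit expression for the `Y(1|2)` Bethe vector, without the overall
sign `(-1)^b` (operator part). -/
def PhiTB (c : ℂ) (T : Fin 3 → Fin 3 → ℂ → A) (lam2 : ℂ → ℂ) (u v : List ℂ) : A :=
  ∑ S : Finset (Fin u.length), ∑ Q : Finset (Fin v.length),
    if S.card = Q.card then
      (KizL c (sel u S) (sel v Q) * prodFF c (sel v Q) (sel v Qᶜ) *
          prodGG c (sel u Sᶜ) (sel u S) * lamP lam2 (sel v Q)) •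
        (TT c (T 0 2) (sel u S) * TT c (T 0 1) (sel u Sᶜ) * Tprod (T 1 2) (sel v Qᶜ))
    else 0

/-- First explicit expression for the dual `Y(2|1)` Bethe vector, without the
overall sign `(-1)^{b(b-1)/2}`.  `E` is a right `A`-module, i.e. a left
`Aᵐᵒᵖ`-module; `op X • Ωd` is `Ωd · X`. -/
def PsiA {E : Type*} [AddCommGroup E] [Module ℂ E] [Module Aᵐᵒᵖ E]
    (c : ℂ) (T : Fin 3 → Fin 3 → ℂ → A) (lam2 : ℂ → ℂ) (u v : List ℂ) (Ωd : E) : E :=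
  ∑ S : Finset (Fin u.length), ∑ Q : Finset (Fin v.length),
    if S.card = Q.card then
      (prodGG c (sel v Q) (sel u S) * prodFF c (sel u S) (sel u Sᶜ) *
          prodGG c (sel v Qᶜ) (sel v Q) * prodHHne c (sel u S) * lamP lam2 (sel v Q)) •
        (op (TTrev c (T 2 1) (sel v Qᶜ) * Tprod (T 1 0) (sel u Sᶜ) *
              TTrev c (T 2 0) (sel u S)) • Ωd)
    else 0

/-- The dual `Y(2|1)` Bethe vector `Ψ_{a,b}(ū,v̄)`. -/
def Psi {E : Type*} [AddCommGroup E] [Module ℂ E] [Module Aᵐᵒᵖ E]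
    (c : ℂ) (T : Fin 3 → Fin 3 → ℂ → A) (lam2 : ℂ → ℂ) (u v : List ℂ) (Ωd : E) : E :=
  ((-1 : ℂ) ^ (v.length * (v.length - 1) / 2)) • PsiA c T lam2 u v Ωd

/-- Second explicit expression for the dual `Y(2|1)` Bethe vector, without the
overall sign `(-1)^{b(b-1)/2}`. -/
def PsiB {E : Type*} [AddCommGroup E] [Module ℂ E] [Module Aᵐᵒᵖ E]
    (c : ℂ) (T : Fin 3 → Fin 3 → ℂ → A) (lam2 : ℂ → ℂ) (u v : List ℂ) (Ωd : E) : E :=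
  ∑ S : Finset (Fin u.length), ∑ Q : Finset (Fin v.length),
    if S.card = Q.card then
      (KizL c (sel v Q) (sel u S) * prodFF c (sel u S) (sel u Sᶜ) *
          prodGG c (sel v Qᶜ) (sel v Q) * lamP lam2 (sel u S)) •
        (op (Tprod (T 1 0) (sel u Sᶜ) * TTrev c (T 2 1) (sel v Qᶜ) *
              TTrev c (T 2 0) (sel v Q)) • Ωd)
    else 0


/-! ### Izergin kernel -/

lemma vprod_eq (c : ℂ) {n : ℕ} (vs : Fin n → ℂ) :
    (∏ j : Fin n, ∏ k : Fin n, if (k : ℕ) < (j : ℕ) then gg c (vs j) (vs k) else 1)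
      = (∏ j : Fin n, ∏ k : Fin n, if (k : ℕ) < (j : ℕ) then c else 1) /
        (Matrix.vandermonde vs).det := by
  rw [Matrix.det_vandermonde, Finset.prod_comm]
  rw [Finset.prod_comm (f := fun j k : Fin n => if (k : ℕ) < (j : ℕ) then c else 1)]
  rw [← Finset.prod_div_distrib]
  refine Finset.prod_congr rfl fun i _ => ?_
  have : (Finset.Ioi i) = Finset.univ.filter (fun j : Fin n => (i : ℕ) < j) := by
    ext j; simp
  rw [this, Finset.prod_filter, ← Finset.prod_div_distrib]
  refine Finset.prod_congr rfl fun j _ => ?_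
  split_ifs <;> simp [gg]

lemma vprod_perm (c : ℂ) {n : ℕ} (vs : Fin n → ℂ) (σ : Equiv.Perm (Fin n)) :
    (∏ j : Fin n, ∏ k : Fin n, if (k : ℕ) < (j : ℕ) then gg c (vs (σ j)) (vs (σ k)) else 1)
      = ((Equiv.Perm.sign σ : ℤ) : ℂ) *
       (∏ j : Fin n, ∏ k : Fin n, if (k : ℕ) < (j : ℕ) then gg c (vs j) (vs k) else 1) := by
  have h1 := vprod_eq c (vs ∘ σ)
  simp only [Function.comp] at h1
  rw [h1, vprod_eq]
  have h2 : Matrix.vandermonde (vs ∘ σ) = (Matrix.vandermonde vs).submatrix σ id := by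
    ext i j; simp [Matrix.vandermonde]
  rw [h2, Matrix.det_permute]
  rcases Int.units_eq_one_or (Equiv.Perm.sign σ) with h | h <;> simp [h, div_neg]

lemma gg_neg (c x y : ℂ) : gg (-c) x y = gg c y x := by
  unfold gg; rw [← neg_sub y x, neg_div_neg_eq]

lemma gg_anti (c x y : ℂ) : gg c x y = - gg c y x := by
  unfold gg; rw [← neg_sub y x, div_neg]

lemma sign_sq {n : ℕ} (σ : Equiv.Perm (Fin n)) :
    ((Equiv.Perm.sign σ : ℤ) : ℂ) * ((Equiv.Perm.sign σ : ℤ) : ℂ) = 1 := by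
  rcases Int.units_eq_one_or (Equiv.Perm.sign σ) with h | h <;> simp [h]

lemma Kiz_perm_left (c : ℂ) {n : ℕ} (vs us : Fin n → ℂ) (σ : Equiv.Perm (Fin n)) :
    Kiz c (vs ∘ σ) us = Kiz c vs us := by
  unfold Kiz
  simp only [Function.comp]
  rw [vprod_perm]
  have h2 : (Matrix.of fun j k => gg c (vs (σ j)) (us k) / hh c (vs (σ j)) (us k)) =
    (Matrix.of fun j k => gg c (vs j) (us k) / hh c (vs j) (us k)).submatrix σ id := by
    ext i j; simp
  rw [h2, Matrix.det_permute, Equiv.prod_comp σ (fun j => ∏ k, hh c (vs j) (us k))]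
  linear_combination ((∏ j : Fin n, ∏ k : Fin n, if (k : ℕ) < (j : ℕ) then gg c (vs j) (vs k) else 1) *
    (∏ j : Fin n, ∏ k : Fin n, if (k : ℕ) < (j : ℕ) then gg c (us k) (us j) else 1) *
    (∏ j : Fin n, ∏ k : Fin n, hh c (vs j) (us k)) *
    Matrix.det (Matrix.of fun j k => gg c (vs j) (us k) / hh c (vs j) (us k))) * sign_sq σ

lemma Kiz_perm_right (c : ℂ) {n : ℕ} (vs us : Fin n → ℂ) (σ : Equiv.Perm (Fin n)) :
    Kiz c vs (us ∘ σ) = Kiz c vs us := by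
  unfold Kiz
  simp only [Function.comp]
  have h3 := vprod_perm (-c) us σ
  simp only [gg_neg] at h3
  rw [h3]
  have h2 : (Matrix.of fun j k => gg c (vs j) (us (σ k)) / hh c (vs j) (us (σ k))) =
    (Matrix.of fun j k => gg c (vs j) (us k) / hh c (vs j) (us k)).submatrix id σ := by
    ext i j; simp
  rw [h2, Matrix.det_permute']
  simp_rw [fun j => Equiv.prod_comp σ (fun k => hh c (vs j) (us k))]
  linear_combination ((∏ j : Fin n, ∏ k : Fin n, if (k : ℕ) < (j : ℕ) then gg c (vs j) (vs k) else 1) *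
    (∏ j : Fin n, ∏ k : Fin n, if (k : ℕ) < (j : ℕ) then gg c (us k) (us j) else 1) *
    (∏ j : Fin n, ∏ k : Fin n, hh c (vs j) (us k)) *
    Matrix.det (Matrix.of fun j k => gg c (vs j) (us k) / hh c (vs j) (us k))) * sign_sq σ

lemma exists_perm {n : ℕ} {f g : Fin n → ℂ} (hf : Function.Injective f)
    (hg : Function.Injective g) (h : Set.range f = Set.range g) :
    ∃ σ : Equiv.Perm (Fin n), f = g ∘ σ := by
  refine ⟨(Equiv.ofInjective f hf).trans ((Equiv.setCongr h).trans (Equiv.ofInjective g hg).symm), ?_⟩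
  ext i
  simp only [Function.comp, Equiv.trans_apply]
  rw [Equiv.apply_ofInjective_symm hg]
  rfl

lemma Kiz_congr (c : ℂ) {n : ℕ} {v v' u u' : Fin n → ℂ} (hv : Function.Injective v)
    (hv' : Function.Injective v') (hu : Function.Injective u) (hu' : Function.Injective u')
    (h1 : Set.range v = Set.range v') (h2 : Set.range u = Set.range u') :
    Kiz c v u = Kiz c v' u' := by
  obtain ⟨σ, rfl⟩ := exists_perm hv hv' h1
  obtain ⟨τ, rfl⟩ := exists_perm hu hu' h2
  rw [Kiz_perm_left, Kiz_perm_right]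

lemma KizL_eq (c : ℂ) {n : ℕ} {v u : Fin n → ℂ} {lv lu : List ℂ} (hv : Function.Injective v)
    (hu : Function.Injective u) (hlv : lv.Nodup) (hlu : lu.Nodup)
    (h1 : ∀ x, x ∈ lv ↔ x ∈ Set.range v) (h2 : ∀ x, x ∈ lu ↔ x ∈ Set.range u) :
    KizL c lv lu = Kiz c v u := by
  have a1 : lv.length = n := by
    rw [← List.toFinset_card_of_nodup hlv]
    have : lv.toFinset = Finset.univ.image v := by ext x; simp [h1]
    rw [this, Finset.card_image_of_injective _ hv]; simp
  have a2 : lu.length = n := by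
    rw [← List.toFinset_card_of_nodup hlu]
    have : lu.toFinset = Finset.univ.image u := by ext x; simp [h2]
    rw [this, Finset.card_image_of_injective _ hu]; simp
  subst a1
  unfold KizL
  rw [dif_pos a2.symm]
  refine Kiz_congr c (List.nodup_iff_injective_get.1 hlv) hv ?_ hu ?_ ?_
  · exact (List.nodup_iff_injective_get.1 hlu).comp (Fin.cast_injective _)
  · ext x; rw [← h1, List.mem_iff_get]; rfl
  · ext x; rw [← h2, List.mem_iff_get]
    constructor
    · rintro ⟨i, rfl⟩; exact ⟨_, rfl⟩
    · rintro ⟨i, rfl⟩; exact ⟨Fin.cast a2 i, rfl⟩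

lemma uprod_succAbove (c : ℂ) {n : ℕ} (us : Fin (n+1) → ℂ) (j : Fin (n+1)) :
    (∏ a : Fin (n+1), ∏ b : Fin (n+1), if (b : ℕ) < (a : ℕ) then gg c (us b) (us a) else 1)
      = (-1) ^ (j : ℕ) * (∏ k : Fin n, gg c (us j) (us (j.succAbove k))) *
       (∏ a : Fin n, ∏ b : Fin n, if (b : ℕ) < (a : ℕ) then
          gg c (us (j.succAbove b)) (us (j.succAbove a)) else 1) := by
  rw [Fin.prod_univ_succAbove _ j]
  rw [Fin.prod_univ_succAbove _ j]
  simp_rw [fun x => Fin.prod_univ_succAbove (fun b : Fin (n+1) => if (b : ℕ) < ((j.succAbove x : Fin (n+1)) : ℕ) then gg c (us b) (us (j.succAbove x)) else 1) j]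
  rw [Finset.prod_mul_distrib, if_neg (lt_irrefl _), one_mul, ← mul_assoc, ← Finset.prod_mul_distrib]
  congr 1
  · have h1 : ((-1 : ℂ)) ^ (j : ℕ) = ∏ k : Fin n, if (k : ℕ) < (j : ℕ) then (-1 : ℂ) else 1 := by
      rw [Finset.prod_ite]
      simp only [Finset.prod_const, one_pow, mul_one]
      congr 1
      rw [Fin.card_filter_val_lt]; have := j.2; omega
    rw [h1, ← Finset.prod_mul_distrib]
    refine Finset.prod_congr rfl fun k _ => ?_
    by_cases hk : (k : ℕ) < j
    · have : j.succAbove k = k.castSucc := Fin.succAbove_of_castSucc_lt _ _ hk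
      rw [this]; simp only [Fin.val_castSucc, hk, if_true, not_lt.2 hk.le, if_false]
      rw [gg_anti]; ring
    · have : j.succAbove k = k.succ := Fin.succAbove_of_le_castSucc _ _ (by rw [Fin.le_def]; simpa using hk)
      rw [this]; simp only [Fin.val_succ]
      rw [if_neg (by omega), if_pos (by omega), if_neg hk]
  · refine Finset.prod_congr rfl fun a _ => Finset.prod_congr rfl fun b _ => ?_
    have := (Fin.strictMono_succAbove j).lt_iff_lt (a := b) (b := a)
    simp only [Fin.lt_def] at this
    simp only [this]

lemma Kiz_cons (c : ℂ) {n : ℕ} (z : ℂ) (vs : Fin n → ℂ) (us : Fin (n+1) → ℂ)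
    (hz : ∀ j, hh c z (us j) ≠ 0) :
    Kiz c (Fin.cons z vs : Fin (n+1) → ℂ) us = ∑ j : Fin (n+1), gg c z (us j) *
      (∏ k : Fin n, hh c z (us (j.succAbove k)) * gg c (us j) (us (j.succAbove k))) *
      (∏ q : Fin n, gg c (vs q) z * hh c (vs q) (us j)) * Kiz c vs (us ∘ j.succAbove) := by
  unfold Kiz
  rw [Matrix.det_succ_row_zero, Finset.mul_sum]
  refine Finset.sum_congr rfl fun j _ => ?_
  rw [uprod_succAbove c us j]
  have hsub : (Matrix.of fun j k => gg c ((Fin.cons z vs : Fin (n+1) → ℂ) j) (us k) /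
      hh c ((Fin.cons z vs : Fin (n+1) → ℂ) j) (us k)).submatrix Fin.succ j.succAbove
      = Matrix.of fun a k => gg c (vs a) ((us ∘ j.succAbove) k) / hh c (vs a) ((us ∘ j.succAbove) k) := by
    ext a k; simp
  rw [hsub]
  simp only [Fin.prod_univ_succ (f := fun a : Fin (n+1) => ∏ b : Fin (n+1), if (b : ℕ) < (a : ℕ) then
     gg c ((Fin.cons z vs : Fin (n+1) → ℂ) a) ((Fin.cons z vs : Fin (n+1) → ℂ) b) else 1)]
  simp only [Fin.prod_univ_succ (f := fun b : Fin (n+1) => if (b : ℕ) < ((0 : Fin (n+1)) : ℕ) then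
     gg c ((Fin.cons z vs : Fin (n+1) → ℂ) 0) ((Fin.cons z vs : Fin (n+1) → ℂ) b) else 1)]
  simp_rw [fun a : Fin n => Fin.prod_univ_succ (fun b : Fin (n+1) => if (b : ℕ) < ((a.succ : Fin (n+1)) : ℕ) then
     gg c ((Fin.cons z vs : Fin (n+1) → ℂ) a.succ) ((Fin.cons z vs : Fin (n+1) → ℂ) b) else 1)]
  simp only [Fin.prod_univ_succ (f := fun a : Fin (n+1) => ∏ b : Fin (n+1),
     hh c ((Fin.cons z vs : Fin (n+1) → ℂ) a) (us b))]
  simp_rw [fun x : ℂ => Fin.prod_univ_succAbove (fun b : Fin (n+1) => hh c x (us b)) j]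
  simp only [Fin.cons_zero, Fin.cons_succ, Fin.val_zero, Fin.val_succ, not_lt_zero, if_false,
    Finset.prod_const_one, one_mul, Nat.zero_lt_succ, if_true, Nat.succ_lt_succ_iff,
    Finset.prod_mul_distrib, Matrix.of_apply, Function.comp]
  have hs : ((-1 : ℂ)) ^ (j : ℕ) * (-1) ^ (j : ℕ) = 1 := by
    rw [← mul_pow]; simp
  have hj := hz j
  field_simp
  have h2 : ((-1 : ℂ) ^ (j : ℕ)) ^ 2 = 1 := by rw [sq, hs]
  rw [h2]; ring

/-! ### Set-indexed kernel -/

/-- the kernel indexed by finite sets -/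
def KS (c : ℂ) (Q S : Finset ℂ) : ℂ := KizL c Q.toList S.toList

lemma exists_enum {n : ℕ} (S : Finset ℂ) (h : S.card = n) :
    ∃ us : Fin n → ℂ, Function.Injective us ∧ Finset.univ.image us = S := by
  refine ⟨fun i => ((S.equivFinOfCardEq h).symm i : ℂ), ?_, ?_⟩
  · exact Subtype.val_injective.comp (Equiv.injective _)
  · ext x
    simp only [Finset.mem_image, Finset.mem_univ, true_and]
    constructor
    · rintro ⟨i, rfl⟩; exact Subtype.coe_prop _
    · intro hx; exact ⟨S.equivFinOfCardEq h ⟨x, hx⟩, by simp⟩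

lemma KS_eq (c : ℂ) {n : ℕ} {v u : Fin n → ℂ} (hv : Function.Injective v)
    (hu : Function.Injective u) :
    KS c (Finset.univ.image v) (Finset.univ.image u) = Kiz c v u :=
  KizL_eq c hv hu (Finset.nodup_toList _) (Finset.nodup_toList _) (by simp) (by simp)

lemma KS_zero (c : ℂ) {Q S : Finset ℂ} (h : Q.card ≠ S.card) : KS c Q S = 0 := by
  unfold KS KizL; rw [dif_neg]; simpa using h

lemma KizL_eq_KS (c : ℂ) {lv lu : List ℂ} (hv : lv.Nodup) (hu : lu.Nodup) :
    KizL c lv lu = KS c lv.toFinset lu.toFinset := by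
  by_cases h : lv.length = lu.length
  · have h1 : lv.toFinset.card = lv.length := List.toFinset_card_of_nodup hv
    have h2 : lu.toFinset.card = lv.length := by rw [h]; exact List.toFinset_card_of_nodup hu
    obtain ⟨v, iv, ev⟩ := exists_enum _ h1
    obtain ⟨u, iu, eu⟩ := exists_enum _ h2
    rw [← ev, ← eu, KS_eq c iv iu]
    refine KizL_eq c iv iu hv hu ?_ ?_
    · intro x; rw [← List.mem_toFinset, ← ev]; simp
    · intro x; rw [← List.mem_toFinset, ← eu]; simp
  · rw [KS_zero]
    · unfold KizL; rw [dif_neg h]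
    · rwa [List.toFinset_card_of_nodup hv, List.toFinset_card_of_nodup hu]

lemma KS_insert (c : ℂ) (z : ℂ) (Q S : Finset ℂ) (hzQ : z ∉ Q) (hz : ∀ j ∈ S, hh c z j ≠ 0) :
    KS c (insert z Q) S = ∑ j ∈ S, gg c z j *
      (∏ k ∈ S.erase j, hh c z k * gg c j k) *
      (∏ q ∈ Q, gg c q z * hh c q j) * KS c Q (S.erase j) := by
  by_cases hcard : S.card = Q.card + 1
  · obtain ⟨us, iu, rfl⟩ := exists_enum S hcard
    obtain ⟨vs, iv, ev⟩ := exists_enum Q rfl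
    have hcons : insert z Q = Finset.univ.image (Fin.cons z vs : Fin (Q.card + 1) → ℂ) := by
      ext x
      simp only [Finset.mem_insert, Finset.mem_image, Finset.mem_univ, true_and, Fin.exists_fin_succ,
        Fin.cons_zero, Fin.cons_succ]
      conv_lhs => rw [← ev]
      simp [eq_comm]
    have icons : Function.Injective (Fin.cons z vs : Fin (Q.card + 1) → ℂ) := by
      rw [Fin.cons_injective_iff]
      refine ⟨?_, iv⟩
      rintro ⟨i, hi⟩; apply hzQ; rw [← ev, ← hi]; simp
    rw [hcons, KS_eq c icons iu, Kiz_cons c z vs us (fun j => hz _ (by simp)),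
      Finset.sum_image (fun a _ b _ h => iu h)]
    refine Finset.sum_congr rfl fun j _ => ?_
    have her : (Finset.univ.image us).erase (us j) = Finset.univ.image (us ∘ j.succAbove) := by
      ext x
      simp only [Finset.mem_erase, Finset.mem_image, Finset.mem_univ, true_and, Function.comp]
      constructor
      · rintro ⟨hx, i, rfl⟩
        obtain ⟨k, hk⟩ := Fin.exists_succAbove_eq (x := i) (y := j) (fun h => hx (by rw [h]))
        exact ⟨k, by rw [hk]⟩
      · rintro ⟨k, rfl⟩
        exact ⟨fun h => Fin.succAbove_ne j k (iu h), _, rfl⟩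
    have ius : Function.Injective (us ∘ j.succAbove) := iu.comp Fin.succAbove_right_injective
    rw [her, Finset.prod_image (fun a _ b _ h => ius h)]
    have hQ : (∏ q ∈ Q, gg c q z * hh c q (us j)) = ∏ q : Fin Q.card, gg c (vs q) z * hh c (vs q) (us j) := by
      conv_lhs => rw [← ev]
      rw [Finset.prod_image (fun a _ b _ h => iv h)]
    have hK : KS c Q (Finset.univ.image (us ∘ j.succAbove)) = Kiz c vs (us ∘ j.succAbove) := by
      have h5 := KS_eq c iv ius
      rw [ev] at h5; exact h5
    rw [hQ, hK]; rfl
  · rw [KS_zero, Finset.sum_eq_zero]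
    · intro j hj
      rw [KS_zero, mul_zero]
      rw [Finset.card_erase_of_mem hj]
      have := Finset.card_pos.2 ⟨j, hj⟩; omega
    · rw [Finset.card_insert_of_notMem hzQ]; omega

lemma KS_vanish (c : ℂ) (Q S : Finset ℂ) (q0 : ℂ) (hq : q0 ∈ Q) (hz : ∀ j ∈ S, hh c q0 j ≠ 0) :
    ∑ j ∈ S, gg c q0 j * (∏ k ∈ S.erase j, hh c q0 k * gg c j k) *
      (∏ q ∈ Q, hh c q j) * KS c Q (S.erase j) = 0 := by
  set G : ℂ → ℂ → ℂ := fun j l => gg c q0 j * gg c q0 l * (hh c q0 l * hh c q0 j) *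
     (∏ k ∈ (S.erase j).erase l, hh c q0 k ^ 2 * gg c j k * gg c l k) *
     (∏ q ∈ Q.erase q0, hh c q j * hh c q l * gg c q q0) * KS c (Q.erase q0) ((S.erase j).erase l) * gg c j l with hG
  have hanti : ∀ j l, G j l = - G l j := by
    intro j l
    simp only [hG]
    rw [Finset.erase_right_comm, gg_anti c j l]
    have e1 : (∏ k ∈ (S.erase l).erase j, hh c q0 k ^ 2 * gg c j k * gg c l k)
       = ∏ k ∈ (S.erase l).erase j, hh c q0 k ^ 2 * gg c l k * gg c j k :=
      Finset.prod_congr rfl fun k _ => by ring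
    have e2 : (∏ q ∈ Q.erase q0, hh c q j * hh c q l * gg c q q0)
       = ∏ q ∈ Q.erase q0, hh c q l * hh c q j * gg c q q0 :=
      Finset.prod_congr rfl fun k _ => by ring
    rw [e1, e2]; ring
  have key : ∀ j ∈ S, gg c q0 j * (∏ k ∈ S.erase j, hh c q0 k * gg c j k) *
      (∏ q ∈ Q, hh c q j) * KS c Q (S.erase j) = ∑ l ∈ S.erase j, G j l := by
    intro j hj
    conv_lhs => rw [← Finset.insert_erase hq]
    rw [KS_insert c q0 (Q.erase q0) (S.erase j) (Finset.notMem_erase _ _)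
      (fun k hk => hz k (Finset.mem_of_mem_erase hk)), Finset.mul_sum]
    refine Finset.sum_congr rfl fun l hl => ?_
    rw [← Finset.mul_prod_erase _ _ hl, Finset.prod_insert (Finset.notMem_erase _ _)]
    simp only [hG, Finset.prod_mul_distrib, Finset.prod_pow]
    ring
  rw [Finset.sum_congr rfl key]
  have hsum : ∀ H : ℂ → ℂ → ℂ, ∑ j ∈ S, ∑ l ∈ S.erase j, H j l = ∑ j ∈ S, ∑ l ∈ S.erase j, H l j := by
    intro H
    refine Finset.sum_comm' ?_
    intro x y; simp only [Finset.mem_erase]; tauto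
  have h1 := hsum G
  have h2 : ∑ j ∈ S, ∑ l ∈ S.erase j, G l j = - ∑ j ∈ S, ∑ l ∈ S.erase j, G j l := by
    rw [← Finset.sum_neg_distrib]
    refine Finset.sum_congr rfl fun j _ => ?_
    rw [← Finset.sum_neg_distrib]
    exact Finset.sum_congr rfl fun l _ => hanti l j
  rw [h2] at h1
  exact self_eq_neg.1 h1

/-! ### Partial fractions -/

lemma pf_gen (c : ℂ) (hc : c ≠ 0) (N : Finset ℂ) (p : Polynomial ℂ) (hp : p.degree < N.card) (z : ℂ)
    (hz : z ∉ N) :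
    p.eval z * ∏ x ∈ N, gg c x z =
      ∑ x ∈ N, gg c x z * p.eval x * ∏ y ∈ N.erase x, gg c y x := by
  have h1 : p = Lagrange.interpolate N id (fun x => p.eval x) :=
    Lagrange.eq_interpolate (Set.injOn_id _) hp
  have h2 := Lagrange.eval_interpolate_not_at_node (s := N) (v := id) (fun x => p.eval x) (x := z)
    (fun i hi h => hz (by rw [h]; exact hi))
  rw [← h1] at h2
  rw [h2, Lagrange.eval_nodal, Finset.mul_sum, Finset.sum_mul]
  refine Finset.sum_congr rfl fun x hx => ?_
  have e1 : (∏ i ∈ N, (z - id i)) * ∏ x ∈ N, gg c x z = ∏ x ∈ N, (-c) := by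
    rw [← Finset.prod_mul_distrib]
    refine Finset.prod_congr rfl fun y hy => ?_
    have : y - z ≠ 0 := sub_ne_zero.2 fun h => hz (h ▸ hy)
    unfold gg; simp only [id]; field_simp; ring
  have e2 : (∏ y ∈ N.erase x, gg c y x) = (∏ y ∈ N.erase x, (-c)) * Lagrange.nodalWeight N id x := by
    unfold Lagrange.nodalWeight
    rw [← Finset.prod_mul_distrib]
    refine Finset.prod_congr rfl fun y hy => ?_
    unfold gg; simp only [id]; rw [← neg_sub x y, div_neg]; ring
  have e3 : ∏ x ∈ N, (-c) = (-c) * ∏ y ∈ N.erase x, (-c) :=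
    (Finset.mul_prod_erase N (fun _ => -c) hx).symm
  rw [e2]
  have e4 : gg c x z = (-c) * (z - id x)⁻¹ := by
    unfold gg; simp only [id]; rw [← neg_sub z x, div_neg]; ring
  calc _ = ((∏ i ∈ N, (z - id i)) * ∏ x ∈ N, gg c x z) * (Lagrange.nodalWeight N id x * (z - id x)⁻¹ * Polynomial.eval x p) := by ring
    _ = _ := by rw [e1, e3, e4]; ring

lemma ff_eq (c : ℂ) (hc : c ≠ 0) (x y : ℂ) : ff c x y = hh c x y * gg c x y := by
  unfold ff hh gg; field_simp

lemma hh_self (c : ℂ) (hc : c ≠ 0) (x : ℂ) : hh c x x = 1 := by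
  unfold hh; field_simp; ring

lemma pf_term (c : ℂ) (hc : c ≠ 0) (M Q R : Finset ℂ) (j z : ℂ) (hM : M.card ≤ Q.card)
    (hjQ : j ∉ Q) (hjR : j ∉ R) (hQR : Disjoint Q R) (hzj : z ≠ j) (hzQ : z ∉ Q) (hzR : z ∉ R) :
    gg c z j * (∏ k ∈ M, hh c z k) * (∏ q ∈ Q, gg c q z) * (∏ r ∈ R, ff c r z) =
      gg c z j * (∏ k ∈ M, hh c j k) * (∏ q ∈ Q, gg c q j) * (∏ r ∈ R, ff c r j) +
      ∑ x ∈ Q, gg c x z * (gg c x j * (∏ k ∈ M, hh c x k) * (∏ q ∈ Q.erase x, gg c q x) *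
        (∏ r ∈ R, ff c r x)) +
      ∑ x ∈ R, gg c x z * (gg c x j * (∏ k ∈ M, hh c x k) * (∏ q ∈ Q, gg c q x) *
        (∏ r ∈ R.erase x, ff c r x)) := by
  set p : Polynomial ℂ := (∏ k ∈ M, (Polynomial.C c⁻¹ * (Polynomial.X - Polynomial.C k + Polynomial.C c))) *
    ∏ r ∈ R, (Polynomial.C c⁻¹ * (Polynomial.C r - Polynomial.X + Polynomial.C c)) with hp
  have pev : ∀ x, p.eval x = (∏ k ∈ M, hh c x k) * ∏ r ∈ R, hh c r x := by
    intro x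
    simp only [hp, Polynomial.eval_mul, Polynomial.eval_prod, Polynomial.eval_C, Polynomial.eval_add,
      Polynomial.eval_sub, Polynomial.eval_X]
    congr 1 <;> exact Finset.prod_congr rfl fun k _ => by unfold hh; ring
  have hjU : j ∉ Q ∪ R := by simp [hjQ, hjR]
  have hcard : (insert j (Q ∪ R)).card = Q.card + R.card + 1 := by
    rw [Finset.card_insert_of_notMem hjU, Finset.card_union_of_disjoint hQR]
  have hdeg : p.degree < ((insert j (Q ∪ R)).card : ℕ) := by
    refine lt_of_le_of_lt Polynomial.degree_le_natDegree ?_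
    have h1 : p.natDegree ≤ M.card + R.card := by
      refine Polynomial.natDegree_mul_le.trans (Nat.add_le_add ?_ ?_)
      · refine (Polynomial.natDegree_prod_le _ _).trans ?_
        refine (Finset.sum_le_card_nsmul _ _ 1 ?_).trans (by simp)
        intro k _
        compute_degree
      · refine (Polynomial.natDegree_prod_le _ _).trans ?_
        refine (Finset.sum_le_card_nsmul _ _ 1 ?_).trans (by simp)
        intro k _
        compute_degree
    rw [hcard]
    exact_mod_cast (by omega : p.natDegree < Q.card + R.card + 1)
  have hz : z ∉ insert j (Q ∪ R) := by simp [hzj, hzQ, hzR]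
  have h := pf_gen c hc _ p hdeg z hz
  rw [Finset.prod_insert hjU, Finset.prod_union hQR, Finset.sum_insert hjU, Finset.sum_union hQR,
    Finset.erase_insert hjU, Finset.prod_union hQR] at h
  have eQ : ∀ x ∈ Q, gg c x z * p.eval x * (∏ y ∈ (insert j (Q ∪ R)).erase x, gg c y x) =
      - (gg c x z * (gg c x j * (∏ k ∈ M, hh c x k) * (∏ q ∈ Q.erase x, gg c q x) *
        (∏ r ∈ R, ff c r x))) := by
    intro x hx
    have hxR : x ∉ R := Finset.disjoint_left.1 hQR hx
    have hxj : j ≠ x := fun h => hjQ (h ▸ hx)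
    rw [Finset.erase_insert_of_ne hxj, Finset.erase_union_distrib, Finset.erase_eq_of_notMem hxR,
      Finset.prod_insert (by simp [hjQ, hjR]),
      Finset.prod_union (hQR.mono_left (Finset.erase_subset _ _)), pev, gg_anti c j x]
    simp only [ff_eq c hc, Finset.prod_mul_distrib]
    ring
  have eR : ∀ x ∈ R, gg c x z * p.eval x * (∏ y ∈ (insert j (Q ∪ R)).erase x, gg c y x) =
      - (gg c x z * (gg c x j * (∏ k ∈ M, hh c x k) * (∏ q ∈ Q, gg c q x) *
        (∏ r ∈ R.erase x, ff c r x))) := by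
    intro x hx
    have hxQ : x ∉ Q := Finset.disjoint_right.1 hQR hx
    have hxj : j ≠ x := fun h => hjR (h ▸ hx)
    rw [Finset.erase_insert_of_ne hxj, Finset.erase_union_distrib, Finset.erase_eq_of_notMem hxQ,
      Finset.prod_insert (by simp [hjQ, hjR]),
      Finset.prod_union (hQR.mono_right (Finset.erase_subset _ _)), pev, gg_anti c j x,
      ← Finset.mul_prod_erase R _ hx, hh_self c hc]
    simp only [ff_eq c hc, Finset.prod_mul_distrib]
    ring
  rw [Finset.sum_congr rfl eQ, Finset.sum_congr rfl eR, Finset.sum_neg_distrib,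
    Finset.sum_neg_distrib, pev, pev, gg_anti c j z] at h
  have hf : ∀ y, (∏ r ∈ R, ff c r y) = (∏ r ∈ R, hh c r y) * ∏ r ∈ R, gg c r y := by
    intro y; simp only [ff_eq c hc, Finset.prod_mul_distrib]
  rw [hf z, hf j]
  linear_combination -h

lemma KS_pf (c : ℂ) (hc : c ≠ 0) (S Q R : Finset ℂ) (z : ℂ) (hSQ : Disjoint S Q)
    (hSR : Disjoint S R) (hQR : Disjoint Q R) (hzS : z ∉ S) (hzQ : z ∉ Q) (hzR : z ∉ R)
    (h1 : ∀ j ∈ S, hh c z j ≠ 0) (h2 : ∀ q ∈ Q, ∀ j ∈ S, hh c q j ≠ 0)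
    (h3 : ∀ r ∈ R, ∀ j ∈ S, hh c r j ≠ 0) :
    (∏ r ∈ R, ff c r z) * KS c (insert z Q) S =
      ∑ j ∈ S, gg c z j * (∏ q ∈ Q, ff c q j) * (∏ r ∈ R, ff c r j) *
        (∏ k ∈ S.erase j, ff c j k) * KS c Q (S.erase j) +
      ∑ k ∈ R, gg c k z * (∏ r ∈ R.erase k, ff c r k) * KS c (insert k Q) S := by
  by_cases hcard : S.card = Q.card + 1
  swap
  · rw [KS_zero, Finset.sum_eq_zero, Finset.sum_eq_zero]
    · simp
    · intro k hk
      rw [KS_zero, mul_zero]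
      rw [Finset.card_insert_of_notMem (Finset.disjoint_right.1 hQR hk)]; omega
    · intro j hj
      rw [KS_zero, mul_zero]
      rw [Finset.card_erase_of_mem hj]
      have := Finset.card_pos.2 ⟨j, hj⟩; omega
    · rw [Finset.card_insert_of_notMem hzQ]; omega
  rw [KS_insert c z Q S hzQ h1, Finset.mul_sum]
  have step : ∀ j ∈ S, (∏ r ∈ R, ff c r z) * (gg c z j *
      (∏ k ∈ S.erase j, hh c z k * gg c j k) *
      (∏ q ∈ Q, gg c q z * hh c q j) * KS c Q (S.erase j)) =
      gg c z j * (∏ q ∈ Q, ff c q j) * (∏ r ∈ R, ff c r j) *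
        (∏ k ∈ S.erase j, ff c j k) * KS c Q (S.erase j) +
      (∑ x ∈ Q, gg c x z * (∏ q ∈ Q.erase x, gg c q x) * (∏ r ∈ R, ff c r x) *
        (gg c x j * (∏ k ∈ S.erase j, hh c x k * gg c j k) * (∏ q ∈ Q, hh c q j) *
          KS c Q (S.erase j))) +
      ∑ x ∈ R, gg c x z * (∏ r ∈ R.erase x, ff c r x) * (gg c x j *
      (∏ k ∈ S.erase j, hh c x k * gg c j k) *
      (∏ q ∈ Q, gg c q x * hh c q j) * KS c Q (S.erase j)) := by
    intro j hj
    have h := pf_term c hc (S.erase j) Q R j z (by rw [Finset.card_erase_of_mem hj]; omega)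
      (Finset.disjoint_left.1 hSQ hj) (Finset.disjoint_left.1 hSR hj) hQR
      (fun h => hzS (h ▸ hj)) hzQ hzR
    have hf : (∏ q ∈ Q, ff c q j) = (∏ r ∈ Q, hh c r j) * ∏ r ∈ Q, gg c r j := by
      simp only [ff_eq c hc, Finset.prod_mul_distrib]
    have hf2 : (∏ k ∈ S.erase j, ff c j k) = (∏ k ∈ S.erase j, hh c j k) * ∏ k ∈ S.erase j, gg c j k := by
      simp only [ff_eq c hc, Finset.prod_mul_distrib]
    rw [hf, hf2]
    have := congrArg (fun t => t * ((∏ k ∈ S.erase j, gg c j k) * (∏ q ∈ Q, hh c q j) * KS c Q (S.erase j))) h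
    simp only [add_mul, Finset.sum_mul] at this
    simp only [Finset.prod_mul_distrib]
    refine Eq.trans ?_ (this.trans ?_)
    · ring
    · congr 1
      · congr 1
        · ring
        · exact Finset.sum_congr rfl fun x _ => by ring
      · exact Finset.sum_congr rfl fun x _ => by ring
  rw [Finset.sum_congr rfl step, Finset.sum_add_distrib, Finset.sum_add_distrib,
    Finset.sum_comm (s := S) (t := Q), Finset.sum_comm (s := S) (t := R)]
  have v0 : ∑ x ∈ Q, ∑ j ∈ S, gg c x z * (∏ q ∈ Q.erase x, gg c q x) * (∏ r ∈ R, ff c r x) *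
        (gg c x j * (∏ k ∈ S.erase j, hh c x k * gg c j k) * (∏ q ∈ Q, hh c q j) *
          KS c Q (S.erase j)) = 0 := by
    refine Finset.sum_eq_zero fun x hx => ?_
    rw [← Finset.mul_sum, KS_vanish c Q S x hx (h2 x hx), mul_zero]
  rw [v0, add_zero]
  congr 1
  refine Finset.sum_congr rfl fun x hx => ?_
  rw [← Finset.mul_sum, KS_insert c x Q S (Finset.disjoint_right.1 hQR hx) (h3 x hx)]

/-! ### Operators -/

lemma rel_odd (c : ℂ) (hc : c ≠ 0) (T : Fin 3 → Fin 3 → ℂ → A) (hT : IsTFam c p21 T) (i : Fin 3)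
    (hi : i = 0 ∨ i = 1) (z w : ℂ) (hzw : z ≠ w) :
    hh c z w • (T i 2 z * T i 2 w) = hh c w z • (T i 2 w * T i 2 z) := by
  have h := hT i 2 i 2 z w hzw
  have hs : z - w ≠ 0 := sub_ne_zero.2 hzw
  have h' := congrArg (fun x => ((z - w) / c) • x) h
  have e : ((z - w) / c) * gg c z w = 1 := by unfold gg; field_simp
  have e1 : hh c z w = (z - w) / c + 1 := by unfold hh; field_simp
  have e2 : hh c w z = 1 - (z - w) / c := by unfold hh; field_simp; ring
  rw [e1, e2]
  rcases hi with rfl | rfl <;>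
  · simp [p21, smul_sub, smul_smul, e] at h'
    rw [add_smul, sub_smul, one_smul, one_smul]
    linear_combination (norm := module) h'

lemma rel_mixed (c : ℂ) (T : Fin 3 → Fin 3 → ℂ → A) (hT : IsTFam c p21 T) (z w : ℂ)
    (hzw : w ≠ z) :
    T 1 2 z * T 0 2 w = -(ff c w z) • (T 0 2 w * T 1 2 z) + gg c w z • (T 0 2 z * T 1 2 w) := by
  have h := hT 0 2 1 2 w z hzw
  have hs : w - z ≠ 0 := sub_ne_zero.2 hzw
  have e : ff c w z = 1 + gg c w z := by unfold ff gg; field_simp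
  rw [e]
  simp [p21, smul_sub] at h
  rw [neg_smul, add_smul, one_smul]
  linear_combination (norm := module) h

lemma rel_even (c : ℂ) (hc : c ≠ 0) (T : Fin 3 → Fin 3 → ℂ → A) (hT : IsTFam c p21 T) (i : Fin 3)
    (hi : i = 0 ∨ i = 1) (z w : ℂ) : Commute (T i 1 z) (T i 1 w) := by
  by_cases hzw : z = w
  · rw [hzw]
  have hs : z - w ≠ 0 := sub_ne_zero.2 hzw
  have h1 := hT i 1 i 1 z w hzw
  have h2 := hT i 1 i 1 w z (Ne.symm hzw)
  have e : gg c w z = - gg c z w := gg_anti c w z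
  have hg : gg c z w ≠ 0 := by unfold gg; exact div_ne_zero hc hs
  have h3 : (2 : ℂ) • (gg c z w • (T i 1 z * T i 1 w - T i 1 w * T i 1 z)) = 0 := by
    rcases hi with rfl | rfl <;>
    · simp [p21, e] at h1 h2
      linear_combination (norm := module) (-1 : ℂ) • h1 - h2
  exact sub_eq_zero.1 ((smul_eq_zero.1 ((smul_eq_zero.1 h3).resolve_left two_ne_zero)).resolve_left hg)

/-- set-indexed normalized product -/
def TS (c : ℂ) (Tij : ℂ → A) (s : Finset ℂ) : A := TT c Tij s.toList

/-- set-indexed product -/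
def PS (Tij : ℂ → A) (s : Finset ℂ) : A := Tprod Tij s.toList

/-- goodness of a predicate set: all shifted differences nonzero -/
def Good (c : ℂ) (W : Set ℂ) : Prop := ∀ x ∈ W, ∀ y ∈ W, hh c x y ≠ 0

lemma TT_cons (c : ℂ) (Tij : ℂ → A) (x : ℂ) (l : List ℂ) :
    TT c Tij (x :: l) = ((l.map fun y => hh c y x).prod)⁻¹ • (Tij x * TT c Tij l) := by
  unfold TT Tprod
  simp only [Hnorm, List.map_cons, List.prod_cons, mul_inv, mul_smul, mul_smul_comm]

lemma TT_perm (c : ℂ) (Tij : ℂ → A)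
    (hrel : ∀ z w, z ≠ w → hh c z w • (Tij z * Tij w) = hh c w z • (Tij w * Tij z))
    {l l' : List ℂ} (h : l.Perm l') (hg : Good c {x | x ∈ l}) : TT c Tij l = TT c Tij l' := by
  induction h with
  | nil => rfl
  | cons x h ih =>
    rw [TT_cons, TT_cons, ih (fun a ha b hb => hg a (List.mem_cons_of_mem _ ha) b (List.mem_cons_of_mem _ hb)),
      (h.map _).prod_eq]
  | swap x y l =>
    simp only [TT_cons, List.map_cons, List.prod_cons, mul_inv, mul_smul, mul_smul_comm, ← mul_assoc]
    by_cases hxy : x = y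
    · rw [hxy]
    have h1 : hh c x y ≠ 0 := hg x (by simp) y (by simp)
    have h2 : hh c y x ≠ 0 := hg y (by simp) x (by simp)
    have e : (hh c x y)⁻¹ • (Tij y * Tij x) = (hh c y x)⁻¹ • (Tij x * Tij y) := by
      rw [inv_smul_eq_iff₀ h1, smul_comm, eq_inv_smul_iff₀ h2]
      exact (hrel x y hxy).symm
    have e' := congrArg (fun t => ((List.map (fun z => hh c z y) l).prod)⁻¹ • ((List.map (fun z => hh c z x) l).prod)⁻¹ • (t * TT c Tij l)) e
    simp only [smul_mul_assoc] at e'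
    rw [smul_comm, smul_comm (hh c x y)⁻¹, smul_comm (((List.map (fun z => hh c z x) l).prod)⁻¹), smul_comm ((hh c y x)⁻¹)] 
    simp only [smul_smul] at e' ⊢
    convert e' using 2 <;> ring
  | trans h1 h2 ih1 ih2 =>
    rw [ih1 hg, ih2 (fun a ha b hb => hg a (h1.mem_iff.2 ha) b (h1.mem_iff.2 hb))]

lemma TT_eq_TS (c : ℂ) (Tij : ℂ → A)
    (hrel : ∀ z w, z ≠ w → hh c z w • (Tij z * Tij w) = hh c w z • (Tij w * Tij z))
    {l : List ℂ} (hl : l.Nodup) (hg : Good c {x | x ∈ l}) : TT c Tij l = TS c Tij l.toFinset :=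
  TT_perm c Tij hrel (List.toFinset_toList hl).symm hg

lemma TS_insert (c : ℂ) (Tij : ℂ → A)
    (hrel : ∀ z w, z ≠ w → hh c z w • (Tij z * Tij w) = hh c w z • (Tij w * Tij z))
    (x : ℂ) (s : Finset ℂ) (hx : x ∉ s) (hg : Good c (insert x s : Finset ℂ)) :
    TS c Tij (insert x s) = (∏ y ∈ s, hh c y x)⁻¹ • (Tij x * TS c Tij s) := by
  unfold TS
  rw [TT_perm c Tij hrel (Finset.toList_insert hx), TT_cons, Finset.prod_map_toList]
  intro a ha b hb
  exact hg a (by simpa using ha) b (by simpa using hb)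

lemma Tprod_eq_PS (Tij : ℂ → A) (hcomm : ∀ z w, Commute (Tij z) (Tij w)) {l : List ℂ}
    (hl : l.Nodup) : Tprod Tij l = PS Tij l.toFinset := by
  unfold PS Tprod
  refine List.Perm.prod_eq' ((List.toFinset_toList hl).symm.map _) ?_
  rw [List.pairwise_map]
  exact List.pairwise_of_forall fun _ _ => hcomm _ _

lemma PS_insert (Tij : ℂ → A) (hcomm : ∀ z w, Commute (Tij z) (Tij w)) (x : ℂ) (s : Finset ℂ)
    (hx : x ∉ s) : PS Tij (insert x s) = Tij x * PS Tij s := by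
  unfold PS Tprod
  rw [List.Perm.prod_eq' ((Finset.toList_insert hx).map _)]
  · simp
  · rw [List.pairwise_map]
    exact List.pairwise_of_forall fun _ _ => hcomm _ _

lemma PS_comm (Tij : ℂ → A) (hcomm : ∀ z w, Commute (Tij z) (Tij w)) (x : ℂ) (s : Finset ℂ) :
    Commute (Tij x) (PS Tij s) := by
  unfold PS Tprod
  refine Commute.list_prod_right _ _ ?_
  intro y hy
  obtain ⟨w, _, rfl⟩ := List.mem_map.1 hy
  exact hcomm _ _

lemma op_move (c : ℂ) (hc : c ≠ 0) (T : Fin 3 → Fin 3 → ℂ → A) (hT : IsTFam c p21 T)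
    (Q : Finset ℂ) : ∀ z : ℂ, z ∉ Q → Good c (insert z Q : Finset ℂ) →
    T 1 2 z * TS c (T 0 2) Q = (∏ q ∈ Q, -ff c q z) • (TS c (T 0 2) Q * T 1 2 z) +
      ∑ k ∈ Q, (gg c k z * ∏ q ∈ Q.erase k, gg c k q) •
        (T 0 2 z * TS c (T 0 2) (Q.erase k) * T 1 2 k) := by
  have hrel := rel_odd c hc T hT 0 (Or.inl rfl)
  induction Q using Finset.induction_on with
  | empty => intro z _ _; simp [TS, TT, Tprod, Hnorm]
  | insert w Q hw ih =>
    intro z hz hg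
    have hzw : z ≠ w := fun h => hz (by simp [h])
    have hzQ : z ∉ Q := fun h => hz (by simp [h])
    have hgw : Good c (insert w Q : Finset ℂ) := fun a ha b hb =>
      hg a (Finset.mem_insert_of_mem ha) b (Finset.mem_insert_of_mem hb)
    have hgz : Good c (insert z Q : Finset ℂ) := by
      intro a ha b hb
      refine hg a ?_ b ?_
      · simp only [Finset.coe_insert, Set.mem_insert_iff, Finset.mem_coe] at ha ⊢; tauto
      · simp only [Finset.coe_insert, Set.mem_insert_iff, Finset.mem_coe] at hb ⊢; tauto
    have hsub : ∀ k, Good c (insert w (Q.erase k) : Finset ℂ) := by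
      intro k a ha b hb
      refine hgw a ?_ b ?_
      · simp only [Finset.coe_insert, Set.mem_insert_iff, Finset.mem_coe, Finset.mem_erase] at ha ⊢; tauto
      · simp only [Finset.coe_insert, Set.mem_insert_iff, Finset.mem_coe, Finset.mem_erase] at hb ⊢; tauto
    have hne : ∀ x ∈ Q, hh c x w ≠ 0 := fun x hx => hg x (by simp [hx]) w (by simp)
    have hP : (∏ y ∈ Q, hh c y w) ≠ 0 := Finset.prod_ne_zero_iff.2 hne
    rw [TS_insert c _ hrel w Q hw hgw, mul_smul_comm, ← mul_assoc, rel_mixed c T hT z w hzw.symm,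
      add_mul, smul_mul_assoc, smul_mul_assoc, mul_assoc, mul_assoc, ih z hzQ hgz, ih w hw hgw,
      Finset.prod_insert hw, Finset.sum_insert hw, Finset.erase_insert hw]
    have hA : (∏ y ∈ Q, hh c y w)⁻¹ * (∏ q ∈ Q, -ff c q w) = ∏ q ∈ Q, gg c w q := by
      rw [inv_mul_eq_div, div_eq_iff hP, ← Finset.prod_mul_distrib]
      refine Finset.prod_congr rfl fun q _ => ?_
      rw [ff_eq c hc, gg_anti c w q]; ring
    have hterm : ∀ k ∈ Q, (gg c k z * ∏ q ∈ (insert w Q).erase k, gg c k q) •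
        (T 0 2 z * TS c (T 0 2) ((insert w Q).erase k) * T 1 2 k) =
        (∏ y ∈ Q, hh c y w)⁻¹ • (-ff c w z • ((gg c k z * ∏ q ∈ Q.erase k, gg c k q) •
          (T 0 2 w * (T 0 2 z * TS c (T 0 2) (Q.erase k) * T 1 2 k))) +
         gg c w z • ((gg c k w * ∏ q ∈ Q.erase k, gg c k q) •
          (T 0 2 z * (T 0 2 w * TS c (T 0 2) (Q.erase k) * T 1 2 k)))) := by
      intro k hk
      have hkw : w ≠ k := fun h => hw (h ▸ hk)
      have hkz : z ≠ k := fun h => hzQ (h ▸ hk)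
      have hwe : w ∉ Q.erase k := fun h => hw (Finset.mem_of_mem_erase h)
      have hwz : hh c w z ≠ 0 := hg w (by simp) z (by simp)
      have hkwne := hne k hk
      have hP2 : (∏ y ∈ Q.erase k, hh c y w) ≠ 0 :=
        Finset.prod_ne_zero_iff.2 fun x hx => hne x (Finset.mem_of_mem_erase hx)
      rw [Finset.erase_insert_of_ne hkw, Finset.prod_insert hwe, TS_insert c _ hrel w _ hwe (hsub k),
        ← Finset.mul_prod_erase Q _ hk]
      have e : T 0 2 w * T 0 2 z = ((hh c w z)⁻¹ * hh c z w) • (T 0 2 z * T 0 2 w) := by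
        rw [mul_smul, hrel z w hzw, smul_smul, inv_mul_cancel₀ hwz, one_smul]
      have e2 : T 0 2 w * (T 0 2 z * TS c (T 0 2) (Q.erase k) * T 1 2 k) =
         ((hh c w z)⁻¹ * hh c z w) • (T 0 2 z * T 0 2 w * TS c (T 0 2) (Q.erase k) * T 1 2 k) := by
        rw [← mul_assoc, ← mul_assoc, e]; simp only [smul_mul_assoc]
      rw [e2]
      simp only [mul_smul_comm, smul_mul_assoc, smul_smul, ← mul_assoc, ← add_smul]
      congr 1
      have s1 : z - w ≠ 0 := sub_ne_zero.2 hzw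
      have s2 : w - z ≠ 0 := sub_ne_zero.2 hzw.symm
      have s3 : k - z ≠ 0 := sub_ne_zero.2 hkz.symm
      have s4 : k - w ≠ 0 := sub_ne_zero.2 hkw.symm
      have core : hh c k w * gg c k z * gg c k w =
          -ff c w z * gg c k z * ((hh c w z)⁻¹ * hh c z w) + gg c w z * gg c k w := by
        rw [ff_eq c hc w z]
        have : -(hh c w z * gg c w z) * gg c k z * ((hh c w z)⁻¹ * hh c z w)
           = - gg c w z * gg c k z * hh c z w := by field_simp
        rw [this]
        unfold hh gg
        field_simp
        ring
      rw [mul_inv]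
      have hk1 : (hh c k w)⁻¹ * hh c k w = 1 := inv_mul_cancel₀ hkwne
      linear_combination ((hh c k w)⁻¹ * (∏ q ∈ Q.erase k, gg c k q) * (∏ y ∈ Q.erase k, hh c y w)⁻¹) * core
        - gg c k z * gg c k w * (∏ q ∈ Q.erase k, gg c k q) * (∏ y ∈ Q.erase k, hh c y w)⁻¹ * hk1
    rw [Finset.sum_congr rfl hterm, ← hA]
    simp only [mul_add, smul_add, Finset.sum_add_distrib, Finset.smul_sum, Finset.mul_sum,
      mul_smul_comm, smul_mul_assoc, smul_smul, ← mul_assoc]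
    module

/-! ### Set-indexed recursion -/

lemma reindex1 {M : Type*} [AddCommMonoid M] (U : Finset ℂ) (F : Finset ℂ → ℂ → M) :
    ∑ S ∈ U.powerset, ∑ j ∈ S, F S j =
      ∑ j ∈ U, ∑ S ∈ (U.erase j).powerset, F (insert j S) j := by
  rw [Finset.sum_comm' (t' := U) (s' := fun j => U.powerset.filter (fun S => j ∈ S))]
  · refine Finset.sum_congr rfl fun j hj => ?_
    refine Finset.sum_nbij' (fun S => S.erase j) (fun S => insert j S) ?_ ?_ ?_ ?_ ?_
    · intro S hS
      simp only [Finset.mem_filter, Finset.mem_powerset] at hS ⊢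
      exact Finset.erase_subset_erase _ hS.1
    · intro S hS
      simp only [Finset.mem_filter, Finset.mem_powerset] at hS ⊢
      refine ⟨Finset.insert_subset hj (hS.trans (Finset.erase_subset _ _)), Finset.mem_insert_self _ _⟩
    · intro S hS
      simp only [Finset.mem_filter, Finset.mem_powerset] at hS
      exact Finset.insert_erase hS.2
    · intro S hS
      simp only [Finset.mem_powerset] at hS
      exact Finset.erase_insert fun h => Finset.notMem_erase j U (hS h)
    · intro S hS
      simp only [Finset.mem_filter, Finset.mem_powerset] at hS
      simp only [Finset.insert_erase hS.2]
  · intro S j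
    simp only [Finset.mem_filter, Finset.mem_powerset]
    constructor
    · rintro ⟨h1, h2⟩; exact ⟨⟨h1, h2⟩, h1 h2⟩
    · rintro ⟨⟨h1, h2⟩, _⟩; exact ⟨h1, h2⟩

lemma reindex2 {M : Type*} [AddCommMonoid M] (V : Finset ℂ) (F : Finset ℂ → ℂ → M) :
    ∑ Q ∈ V.powerset, ∑ k ∈ Q, F Q k =
      ∑ Q ∈ V.powerset, ∑ k ∈ V \ Q, F (insert k Q) k := by
  rw [reindex1]
  refine Finset.sum_comm' ?_
  intro k Q
  simp only [Finset.mem_powerset, Finset.mem_sdiff, Finset.subset_erase]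
  tauto

/-- set-indexed version of `Y` -/
def YS (c : ℂ) (T : Fin 3 → Fin 3 → ℂ → A) (U V : Finset ℂ) : A :=
  ∑ S ∈ U.powerset, ∑ Q ∈ V.powerset,
    (KS c Q S * (∏ x ∈ S, ∏ y ∈ U \ S, ff c x y) * (∏ x ∈ V \ Q, ∏ y ∈ Q, gg c x y)) •
      (TS c (T 0 2) Q * TS c (T 1 2) (V \ Q) * PS (T 0 1) (U \ S) * PS (T 1 1) S)

lemma Good.mono {c : ℂ} {W W' : Set ℂ} (h : Good c W) (h' : W' ⊆ W) : Good c W' :=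
  fun x hx y hy => h x (h' hx) y (h' hy)

lemma YS_rec (c : ℂ) (hc : c ≠ 0) (T : Fin 3 → Fin 3 → ℂ → A) (hT : IsTFam c p21 T)
    (U V : Finset ℂ) (z : ℂ) (hzU : z ∉ U) (hzV : z ∉ V) (hUV : Disjoint U V)
    (hg : Good c {x | x = z ∨ x ∈ U ∨ x ∈ V}) :
    (∏ y ∈ V, hh c y z) • YS c T U (insert z V) = T 1 2 z * YS c T U V +
      ∑ j ∈ U, (gg c z j * (∏ x ∈ V, ff c x j) * (∏ y ∈ U.erase j, ff c j y)) •
        (T 0 2 z * YS c T (U.erase j) V * T 1 1 j) := by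
  have hrel0 := rel_odd c hc T hT 0 (Or.inl rfl)
  have hrel1 := rel_odd c hc T hT 1 (Or.inr rfl)
  have hcom1 := rel_even c hc T hT 1 (Or.inr rfl)
  have hgV : ∀ s : Finset ℂ, s ⊆ insert z V → Good c (s : Set ℂ) := by
    intro s hs
    refine hg.mono fun x hx => ?_
    have := hs hx
    simp only [Finset.mem_insert] at this
    simp only [Set.mem_setOf_eq]; tauto
  set B : Finset ℂ → Finset ℂ → A := fun S Q =>
    T 0 2 z * TS c (T 0 2) Q * TS c (T 1 2) (V \ Q) * PS (T 0 1) (U \ S) * PS (T 1 1) S with hB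
  set E : Finset ℂ → Finset ℂ → ℂ := fun S Q =>
    (∏ x ∈ S, ∏ y ∈ U \ S, ff c x y) * (∏ x ∈ V \ Q, ∏ y ∈ Q, gg c x y) with hE
  set AA : Finset ℂ → Finset ℂ → A := fun S Q =>
    (KS c Q S * E S Q * ∏ q ∈ Q, -ff c q z) •
     (TS c (T 0 2) Q * T 1 2 z * TS c (T 1 2) (V \ Q) * PS (T 0 1) (U \ S) * PS (T 1 1) S) with hAA
  -- left side
  have hLHS : (∏ y ∈ V, hh c y z) • YS c T U (insert z V) =
      ∑ S ∈ U.powerset, ∑ Q ∈ V.powerset, (AA S Q +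
        ((∏ r ∈ V \ Q, ff c r z) * KS c (insert z Q) S * E S Q) • B S Q) := by
    unfold YS
    rw [Finset.smul_sum]
    refine Finset.sum_congr rfl fun S hS => ?_
    rw [Finset.sum_powerset_insert hzV, Finset.sum_add_distrib, smul_add, Finset.smul_sum,
      Finset.smul_sum]
    congr 1
    · refine Finset.sum_congr rfl fun Q hQ => ?_
      have hQV := Finset.mem_powerset.1 hQ
      have hzQ : z ∉ Q := fun h => hzV (hQV h)
      have hzR : z ∉ V \ Q := fun h => hzV (Finset.mem_sdiff.1 h).1
      rw [Finset.insert_sdiff_of_notMem _ hzQ, Finset.prod_insert hzR,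
        TS_insert c _ hrel1 z _ hzR (hgV _ (Finset.insert_subset_insert _ Finset.sdiff_subset)),
        ← Finset.prod_sdiff hQV]
      have hne : (∏ y ∈ V \ Q, hh c y z) ≠ 0 := Finset.prod_ne_zero_iff.2 fun x hx =>
        hg x (Or.inr (Or.inr (Finset.mem_sdiff.1 hx).1)) z (Or.inl rfl)
      have hf : (∏ q ∈ Q, -ff c q z) = (∏ q ∈ Q, hh c q z) * ∏ q ∈ Q, gg c z q := by
        rw [← Finset.prod_mul_distrib]
        refine Finset.prod_congr rfl fun q _ => ?_
        rw [ff_eq c hc, gg_anti c z q]; ring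
      simp only [hAA, hE, hf, mul_smul_comm, smul_mul_assoc, smul_smul, ← mul_assoc]
      congr 1
      field_simp
    · refine Finset.sum_congr rfl fun Q hQ => ?_
      have hQV := Finset.mem_powerset.1 hQ
      have hzQ : z ∉ Q := fun h => hzV (hQV h)
      rw [Finset.insert_sdiff_insert, Finset.sdiff_insert_of_notMem hzV,
        TS_insert c _ hrel0 z _ hzQ (hgV _ (Finset.insert_subset_insert _ hQV)),
        ← Finset.prod_sdiff hQV]
      have hne : (∏ y ∈ Q, hh c y z) ≠ 0 := Finset.prod_ne_zero_iff.2 fun x hx =>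
        hg x (Or.inr (Or.inr (hQV hx))) z (Or.inl rfl)
      have hf : (∏ q ∈ V \ Q, ff c q z) = (∏ q ∈ V \ Q, hh c q z) * ∏ q ∈ V \ Q, gg c q z := by
        simp only [ff_eq c hc, Finset.prod_mul_distrib]
      simp only [Finset.prod_insert hzQ, Finset.prod_mul_distrib]
      simp only [hB, hE, hf, mul_smul_comm, smul_mul_assoc, smul_smul, ← mul_assoc]
      congr 1
      field_simp
  -- first term on the right
  have hR1 : T 1 2 z * YS c T U V = ∑ S ∈ U.powerset, ∑ Q ∈ V.powerset, (AA S Q +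
        ∑ k ∈ V \ Q, (gg c k z * (∏ r ∈ (V \ Q).erase k, ff c r k) * KS c (insert k Q) S * E S Q) • B S Q) := by
    unfold YS
    rw [Finset.mul_sum]
    refine Finset.sum_congr rfl fun S hS => ?_
    rw [Finset.mul_sum, Finset.sum_add_distrib]
    have h1 : ∀ Q ∈ V.powerset, T 1 2 z * ((KS c Q S * (∏ x ∈ S, ∏ y ∈ U \ S, ff c x y) * (∏ x ∈ V \ Q, ∏ y ∈ Q, gg c x y)) •
      (TS c (T 0 2) Q * TS c (T 1 2) (V \ Q) * PS (T 0 1) (U \ S) * PS (T 1 1) S)) = AA S Q +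
       ∑ k ∈ Q, (KS c Q S * E S Q * (gg c k z * ∏ q ∈ Q.erase k, gg c k q)) •
        (T 0 2 z * TS c (T 0 2) (Q.erase k) * T 1 2 k * TS c (T 1 2) (V \ Q) * PS (T 0 1) (U \ S) * PS (T 1 1) S) := by
      intro Q hQ
      have hQV := Finset.mem_powerset.1 hQ
      have hzQ : z ∉ Q := fun h => hzV (hQV h)
      rw [mul_smul_comm, ← mul_assoc, ← mul_assoc, ← mul_assoc,
        op_move c hc T hT Q z hzQ (hgV _ (Finset.insert_subset_insert _ hQV))]
      simp only [add_mul, Finset.sum_mul, smul_add, Finset.smul_sum, smul_mul_assoc, smul_smul, hAA, hE,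
        ← mul_assoc]
    rw [Finset.sum_congr rfl h1, Finset.sum_add_distrib]
    congr 1
    rw [reindex2]
    refine Finset.sum_congr rfl fun Q hQ => Finset.sum_congr rfl fun k hk => ?_
    have hQV := Finset.mem_powerset.1 hQ
    have hkQ : k ∉ Q := (Finset.mem_sdiff.1 hk).2
    have hkV : k ∈ V := (Finset.mem_sdiff.1 hk).1
    have hs : V \ insert k Q = (V \ Q).erase k := by
      ext x; simp only [Finset.mem_sdiff, Finset.mem_insert, Finset.mem_erase]; tauto
    have hTS : TS c (T 1 2) (V \ Q) = (∏ y ∈ (V \ Q).erase k, hh c y k)⁻¹ •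
        (T 1 2 k * TS c (T 1 2) ((V \ Q).erase k)) := by
      rw [← TS_insert c _ hrel1 k _ (Finset.notMem_erase _ _), Finset.insert_erase hk]
      rw [Finset.insert_erase hk]
      exact hgV _ (Finset.sdiff_subset.trans (Finset.subset_insert _ _))
    have hne : (∏ y ∈ (V \ Q).erase k, hh c y k) ≠ 0 := Finset.prod_ne_zero_iff.2 fun x hx =>
        hg x (Or.inr (Or.inr (Finset.mem_sdiff.1 (Finset.mem_of_mem_erase hx)).1)) k (Or.inr (Or.inr hkV))
    have hf : (∏ r ∈ (V \ Q).erase k, ff c r k) =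
        (∏ r ∈ (V \ Q).erase k, hh c r k) * ∏ r ∈ (V \ Q).erase k, gg c r k := by
      simp only [ff_eq c hc, Finset.prod_mul_distrib]
    have hEE : E S (insert k Q) * (∏ q ∈ Q, gg c k q) = (∏ r ∈ (V \ Q).erase k, gg c r k) * E S Q := by
      simp only [hE]
      rw [hs, ← Finset.mul_prod_erase (V \ Q) _ hk]
      simp only [Finset.prod_insert hkQ, Finset.prod_mul_distrib]
      ring
    rw [Finset.erase_insert hkQ, hf]
    simp only [hB, hTS, hs, mul_smul_comm, smul_mul_assoc, smul_smul, ← mul_assoc]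
    congr 1
    field_simp
    linear_combination (KS c (insert k Q) S * gg c k z) * hEE
  -- second term on the right
  have hR2 : ∑ j ∈ U, (gg c z j * (∏ x ∈ V, ff c x j) * (∏ y ∈ U.erase j, ff c j y)) •
        (T 0 2 z * YS c T (U.erase j) V * T 1 1 j) =
      ∑ S ∈ U.powerset, ∑ Q ∈ V.powerset, ∑ j ∈ S,
        (gg c z j * (∏ q ∈ Q, ff c q j) * (∏ r ∈ V \ Q, ff c r j) *
        (∏ k ∈ S.erase j, ff c j k) * KS c Q (S.erase j) * E S Q) • B S Q := by
    simp_rw [Finset.sum_comm (s := V.powerset)]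
    rw [reindex1]
    refine Finset.sum_congr rfl fun j hj => ?_
    unfold YS
    rw [Finset.mul_sum, Finset.sum_mul, Finset.smul_sum]
    refine Finset.sum_congr rfl fun S hS => ?_
    rw [Finset.mul_sum, Finset.sum_mul, Finset.smul_sum]
    refine Finset.sum_congr rfl fun Q hQ => ?_
    have hQV := Finset.mem_powerset.1 hQ
    have hSU := Finset.mem_powerset.1 hS
    have hjS : j ∉ S := fun h => Finset.notMem_erase j U (hSU h)
    have hs : U \ insert j S = U.erase j \ S := by
      ext x; simp only [Finset.mem_sdiff, Finset.mem_insert, Finset.mem_erase]; tauto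
    have hEE : E (insert j S) Q = (∏ y ∈ U.erase j \ S, ff c j y) *
        (∏ x ∈ S, ∏ y ∈ U.erase j \ S, ff c x y) * (∏ x ∈ V \ Q, ∏ y ∈ Q, gg c x y) := by
      simp only [hE]
      rw [Finset.prod_insert hjS, hs]
    rw [hEE, Finset.erase_insert hjS, ← Finset.prod_sdiff hQV, ← Finset.prod_sdiff hSU]
    simp only [hB]
    rw [hs, PS_insert _ hcom1 j S hjS, (PS_comm _ hcom1 j S).eq]
    simp only [mul_smul_comm, smul_mul_assoc, smul_smul, ← mul_assoc]
    congr 1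
    ring
  rw [hLHS, hR1, hR2, ← Finset.sum_add_distrib]
  refine Finset.sum_congr rfl fun S hS => ?_
  rw [← Finset.sum_add_distrib]
  refine Finset.sum_congr rfl fun Q hQ => ?_
  have hQV := Finset.mem_powerset.1 hQ
  have hSU := Finset.mem_powerset.1 hS
  rw [add_assoc]
  congr 1
  rw [← Finset.sum_smul, ← Finset.sum_smul, ← add_smul]
  congr 1
  rw [← Finset.sum_mul, ← Finset.sum_mul, ← add_mul]
  congr 1
  have hSV : Disjoint S V := hUV.mono_left hSU
  rw [KS_pf c hc S Q (V \ Q) z (hSV.mono_right hQV) (hSV.mono_right Finset.sdiff_subset)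
    Finset.disjoint_sdiff (fun h => hzU (hSU h)) (fun h => hzV (hQV h))
    (fun h => hzV (Finset.mem_sdiff.1 h).1)
    (fun j hj => hg z (Or.inl rfl) j (Or.inr (Or.inl (hSU hj))))
    (fun q hq j hj => hg q (Or.inr (Or.inr (hQV hq))) j (Or.inr (Or.inl (hSU hj))))
    (fun q hq j hj => hg q (Or.inr (Or.inr (Finset.mem_sdiff.1 hq).1)) j (Or.inr (Or.inl (hSU hj)))),
    add_comm]

/-! ### From lists to sets -/

lemma sel_nodup {l : List ℂ} (hl : l.Nodup) (S : Finset (Fin l.length)) : (sel l S).Nodup := by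
  unfold sel
  exact (Finset.sort_nodup _ _).map (List.nodup_iff_injective_get.1 hl)

lemma sel_toFinset (l : List ℂ) (S : Finset (Fin l.length)) :
    (sel l S).toFinset = S.image l.get := by
  ext x; simp [sel]

lemma image_compl {l : List ℂ} (hl : l.Nodup) (S : Finset (Fin l.length)) :
    Sᶜ.image l.get = l.toFinset \ S.image l.get := by
  have hi := List.nodup_iff_injective_get.1 hl
  ext x
  simp only [Finset.mem_image, Finset.mem_compl, Finset.mem_sdiff, List.mem_toFinset, List.mem_iff_get]
  constructor
  · rintro ⟨i, hiS, rfl⟩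
    refine ⟨⟨i, rfl⟩, ?_⟩
    rintro ⟨k, hk, hkk⟩
    exact hiS (hi hkk ▸ hk)
  · rintro ⟨⟨i, rfl⟩, h⟩
    exact ⟨i, fun hS => h ⟨i, hS, rfl⟩, rfl⟩

lemma sum_image_get {M : Type*} [AddCommMonoid M] {l : List ℂ} (hl : l.Nodup)
    (F : Finset ℂ → M) :
    ∑ S : Finset (Fin l.length), F (S.image l.get) = ∑ S ∈ l.toFinset.powerset, F S := by
  have hi := List.nodup_iff_injective_get.1 hl
  refine Finset.sum_bij (fun S _ => S.image l.get) ?_ ?_ ?_ ?_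
  · intro S _
    rw [Finset.mem_powerset]
    intro x hx
    obtain ⟨i, _, rfl⟩ := Finset.mem_image.1 hx
    simp
  · intro S _ S' _ h
    exact Finset.image_injective hi h
  · intro S hS
    refine ⟨Finset.univ.filter (fun i => l.get i ∈ S), Finset.mem_univ _, ?_⟩
    ext x
    simp only [Finset.mem_image, Finset.mem_filter, Finset.mem_univ, true_and]
    constructor
    · rintro ⟨i, h, rfl⟩; exact h
    · intro hx
      have := Finset.mem_powerset.1 hS hx
      rw [List.mem_toFinset, List.mem_iff_get] at this
      obtain ⟨i, rfl⟩ := this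
      exact ⟨i, hx, rfl⟩
  · intro S _; rfl

lemma list_prod_nodup {l : List ℂ} (hl : l.Nodup) (F : ℂ → ℂ) :
    (l.map F).prod = ∏ x ∈ l.toFinset, F x := (List.prod_toFinset F hl).symm

lemma Y_eq_YS (c : ℂ) (hc : c ≠ 0) (T : Fin 3 → Fin 3 → ℂ → A) (hT : IsTFam c p21 T)
    (u v : List ℂ) (hu : u.Nodup) (hv : v.Nodup) (hg : Good c {x | x ∈ v}) :
    Y c T u v = YS c T u.toFinset v.toFinset := by
  have hrel0 := rel_odd c hc T hT 0 (Or.inl rfl)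
  have hrel1 := rel_odd c hc T hT 1 (Or.inr rfl)
  have hcom0 := rel_even c hc T hT 0 (Or.inl rfl)
  have hcom1 := rel_even c hc T hT 1 (Or.inr rfl)
  unfold Y YS
  rw [← sum_image_get hu]
  refine Finset.sum_congr rfl fun S _ => ?_
  rw [← sum_image_get hv]
  refine Finset.sum_congr rfl fun Q _ => ?_
  have hgs : ∀ Q, Good c {x | x ∈ sel v Q} := by
    intro Q
    refine hg.mono fun x hx => ?_
    simp only [sel, List.mem_map, Set.mem_setOf_eq] at hx ⊢
    obtain ⟨i, _, rfl⟩ := hx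
    exact List.get_mem _ _
  rw [KizL_eq_KS c (sel_nodup hv _) (sel_nodup hu _)]
  unfold prodFF prodGG
  simp only [list_prod_nodup (sel_nodup hu _), list_prod_nodup (sel_nodup hv _)]
  rw [TT_eq_TS c _ hrel0 (sel_nodup hv _) (hgs _), TT_eq_TS c _ hrel1 (sel_nodup hv _) (hgs _),
    Tprod_eq_PS _ hcom0 (sel_nodup hu _), Tprod_eq_PS _ hcom1 (sel_nodup hu _)]
  simp only [sel_toFinset, image_compl hu, image_compl hv]
  split_ifs with h
  · rfl
  · rw [KS_zero]
    · simp
    · rw [Finset.card_image_of_injective _ (List.nodup_iff_injective_get.1 hv),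
        Finset.card_image_of_injective _ (List.nodup_iff_injective_get.1 hu)]
      exact fun h' => h h'.symm

lemma eraseIdx_toFinset {u : List ℂ} (hu : u.Nodup) (j : Fin u.length) :
    (u.eraseIdx (j : ℕ)).toFinset = u.toFinset.erase (u.get j) := by
  have h : u.eraseIdx (j : ℕ) = u.erase (u.get j) := by
    rw [List.get_eq_getElem, hu.erase_getElem]
  rw [h]
  ext x
  simp [hu.mem_erase_iff]

/-- recursion for the operator `Y_{a,b}(ū,v̄)`. -/
theorem statement4 (c : ℂ) (hc : c ≠ 0) (T : Fin 3 → Fin 3 → ℂ → A)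
    (hT : IsTFam c p21 T) (u v' : List ℂ) (vb : ℂ)
    (hadm : Admissible c (u ++ (v' ++ [vb]))) :
    (prodHH c v' [vb]) • Y c T u (v' ++ [vb])
      = T 1 2 vb * Y c T u v'
        + ∑ j : Fin u.length,
            (gg c vb (u.get j) * prodFF c v' [u.get j] *
                prodFF c [u.get j] (u.eraseIdx (j : ℕ))) •
              (T 0 2 vb * Y c T (u.eraseIdx (j : ℕ)) v' * T 1 1 (u.get j)) := by
  have hnd : (u ++ (v' ++ [vb])).Nodup := hadm.imp fun h => h.1
  have hgood : Good c {x | x ∈ u ++ (v' ++ [vb])} := by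
    intro x hx y hy
    by_cases hxy : x = y
    · rw [hxy, hh_self c hc]; exact one_ne_zero
    · haveI : Std.Symm (fun x y : ℂ => x ≠ y ∧ x - y + c ≠ 0 ∧ y - x + c ≠ 0) :=
        ⟨fun _ _ h => ⟨h.1.symm, h.2.2, h.2.1⟩⟩
      have := List.Pairwise.forall (R := fun x y : ℂ => x ≠ y ∧ x - y + c ≠ 0 ∧ y - x + c ≠ 0)
        hadm hx hy hxy
      exact div_ne_zero this.2.1 hc
  have hu : u.Nodup := (List.nodup_append.1 hnd).1
  have hvv : (v' ++ [vb]).Nodup := (List.nodup_append.1 hnd).2.1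
  have hv : v'.Nodup := (List.nodup_append.1 hvv).1
  have hz : vb ∉ v' := fun h => (List.nodup_append.1 hvv).2.2 vb h vb (by simp) rfl
  have huv : ∀ x ∈ u, x ∉ v' ++ [vb] := fun x hx h => (List.nodup_append.1 hnd).2.2 x hx x h rfl
  have hgv : Good c {x | x ∈ v' ++ [vb]} := hgood.mono fun x hx => List.mem_append_right _ hx
  have hgv' : Good c {x | x ∈ v'} := hgv.mono fun x hx => List.mem_append_left _ hx
  have hins : (v' ++ [vb]).toFinset = insert vb v'.toFinset := by
    ext x; simp [or_comm]
  have key := YS_rec c hc T hT u.toFinset v'.toFinset vb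
    (fun h => huv vb (List.mem_toFinset.1 h) (by simp)) (by simpa using hz)
    (by
      rw [Finset.disjoint_left]
      intro x hx hx'
      exact huv x (List.mem_toFinset.1 hx) (List.mem_append_left _ (List.mem_toFinset.1 hx')))
    (hgood.mono (by
      intro x hx
      simp only [Set.mem_setOf_eq, List.mem_toFinset, List.mem_append, List.mem_singleton] at hx ⊢
      tauto))
  rw [Y_eq_YS c hc T hT _ _ hu hvv hgv, Y_eq_YS c hc T hT _ _ hu hv hgv', hins]
  have hH : prodHH c v' [vb] = ∏ y ∈ v'.toFinset, hh c y vb := by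
    unfold prodHH
    rw [← list_prod_nodup hv]; simp
  rw [hH, key]
  congr 1
  have himg : u.toFinset = Finset.univ.image u.get := by
    ext x; simp [List.mem_iff_get]
  conv_lhs => rw [himg]
  rw [Finset.sum_image (fun a _ b _ h => List.nodup_iff_injective_get.1 hu h)]
  refine Finset.sum_congr rfl fun j _ => ?_
  have hue : (u.eraseIdx (j : ℕ)).Nodup := hu.sublist (List.eraseIdx_sublist _ _)
  rw [Y_eq_YS c hc T hT _ _ hue hv hgv', eraseIdx_toFinset hu, ← himg, ← eraseIdx_toFinset hu]
  have h1 : prodFF c v' [u.get j] = ∏ x ∈ v'.toFinset, ff c x (u.get j) := by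
    unfold prodFF
    rw [← list_prod_nodup hv]; simp
  have h2 : prodFF c [u.get j] (u.eraseIdx (j : ℕ)) =
      ∏ y ∈ (u.eraseIdx (j : ℕ)).toFinset, ff c (u.get j) y := by
    unfold prodFF
    rw [← list_prod_nodup hue]; simp
  rw [h1, h2]

end Bethe
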